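/- arXiv:2112.12881 — 3 statements merged into one kernel-verified Lean document; each statement's English description precedes it below -/
import Mathlib

section
/- Let F be a ≤*-unbounded family of monotone (nondecreasing) functions f : ℕ → ℕ, and let x, y : ℕ × ℕ → Bool. If for every f ∈ F the set {(n,m) : m < f(n) and x(n,m) ≠ y(n,m)} is finite (i.e., [x↾f] = [y↾f] for every f ∈ F), then x E₁ y. -/
/-- If `F` is a `≤*`-unbounded family of monotone functions and
`[x↾f] = [y↾f]` for every `f ∈ F` (i.e. `x` and `y` differ at only finitely many points
below the graph of each `f ∈ F`), then `x E₁ y`. -/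
theorem stmt_6 (F : Set (ℕ → ℕ)) (hmono : ∀ f ∈ F, Monotone f)
    (hF : ¬ ∃ g : ℕ → ℕ, ∀ f ∈ F, ∃ N : ℕ, ∀ n ≥ N, f n ≤ g n)
    (x y : ℕ × ℕ → Bool)
    (h : ∀ f ∈ F, {p : ℕ × ℕ | p.2 < f p.1 ∧ x p ≠ y p}.Finite) :
    ∃ N : ℕ, ∀ n ≥ N, ∀ m : ℕ, x (n, m) = y (n, m) := by
  by_contra! hne
  choose k hk m hm using hne
  refine hF ⟨m, fun f hf => ?_⟩
  obtain ⟨N, hN⟩ := ((h f hf).image Prod.fst).bddAbove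
  refine ⟨N + 1, fun n hn => ?_⟩
  by_contra! hlt
  have hkN : k n ≤ N :=
    hN ⟨(k n, m n), ⟨hlt.trans_le (hmono f hf (hk n)), hm n⟩, rfl⟩
  have := hk n
  omega
end

section
/- Let F be a ≤*-unbounded family of monotone (nondecreasing) functions f : ℕ → ℕ. Then the map c sending x : ℕ × ℕ → Bool to the F-indexed family of finite-difference classes ([x↾f])_{f∈F} is a complete classification of E₁: for all x, y : ℕ × ℕ → Bool, x E₁ y if and only if for every f ∈ F the set {(n,m) : m < f(n) and x(n,m) ≠ y(n,m)} is finite. -/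
/-- If `F` is a `≤*`-unbounded family of monotone functions, then
`x ↦ ([x↾f])_{f ∈ F}` is a complete classification of `E₁`: `x E₁ y` iff for each `f ∈ F`
the set of points below the graph of `f` at which `x` and `y` differ is finite. -/
theorem stmt_7 (F : Set (ℕ → ℕ)) (hmono : ∀ f ∈ F, Monotone f)
    (hF : ¬ ∃ g : ℕ → ℕ, ∀ f ∈ F, ∃ N : ℕ, ∀ n ≥ N, f n ≤ g n)
    (x y : ℕ × ℕ → Bool) :
    (∃ N : ℕ, ∀ n ≥ N, ∀ m : ℕ, x (n, m) = y (n, m)) ↔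
      ∀ f ∈ F, {p : ℕ × ℕ | p.2 < f p.1 ∧ x p ≠ y p}.Finite := by
  constructor
  · rintro ⟨N, hN⟩ f -
    refine ((Finset.range N).sigma fun n => Finset.range (f n)).finite_toSet.image
      (fun q => (q.1, q.2)) |>.subset ?_
    rintro ⟨n, m⟩ ⟨hm, hne⟩
    have hn : n < N := by
      by_contra! h
      exact hne (hN n h m)
    exact ⟨⟨n, m⟩, by simpa using ⟨hn, hm⟩, rfl⟩
  · intro hfin
    by_contra! hE
    choose col hcol row hrow using hE
    refine hF ⟨row, fun f hf => ?_⟩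
    obtain ⟨B, hB⟩ := ((hfin f hf).image Prod.fst).bddAbove
    refine ⟨B + 1, fun n hn => (hmono f hf (hcol n)).trans ?_⟩
    by_contra! hlt
    have hle : col n ≤ B := hB ⟨(col n, row n), ⟨hlt, hrow n⟩, rfl⟩
    have := hcol n
    omega
end

section
/- Let 𝔟 denote the least cardinality of a ≤*-unbounded subset of ℕ^ℕ. There exists a family F ⊆ ℕ^ℕ of monotone functions with cardinality 𝔟 such that the map x ↦ ([x↾f])_{f∈F}, assigning to each x : ℕ × ℕ → Bool the 𝔟-indexed family of finite-difference classes of its restrictions below the graphs of the members of F, is a complete classification of E₁: for all x, y, x E₁ y iff for every f ∈ F the set {(n,m) : m < f(n) and x(n,m) ≠ y(n,m)} is finite. -/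
/-- Two matrices that agree on all but finitely many columns differ at only finitely many
points below the graph of any function. -/
theorem finite_diff_below_of_eventually_eq {x y : ℕ × ℕ → Bool}
    (h : ∃ N : ℕ, ∀ n ≥ N, ∀ m : ℕ, x (n, m) = y (n, m)) (f : ℕ → ℕ) :
    {p : ℕ × ℕ | p.2 < f p.1 ∧ x p ≠ y p}.Finite := by
  obtain ⟨N, hN⟩ := h
  refine ((Finset.range N).sigma fun n => Finset.range (f n)).finite_toSet.image
    (fun q => (q.1, q.2)) |>.subset ?_
  rintro ⟨n, m⟩ ⟨hm, hne⟩
  refine ⟨⟨n, m⟩, ?_, rfl⟩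
  have hn : n < N := by
    by_contra hn
    exact hne (hN n (not_lt.mp hn) m)
  simpa using ⟨hn, hm⟩

/-- If two matrices differ at only finitely many points below the graph of each member of a
`≤*`-unbounded family of monotone functions, they agree on all but finitely many columns. -/
theorem eventually_eq_of_finite_diff_below {F : Set (ℕ → ℕ)} (hmono : ∀ f ∈ F, Monotone f)
    (hF : ¬ ∃ g : ℕ → ℕ, ∀ f ∈ F, ∃ N : ℕ, ∀ n ≥ N, f n ≤ g n) {x y : ℕ × ℕ → Bool}
    (h : ∀ f ∈ F, {p : ℕ × ℕ | p.2 < f p.1 ∧ x p ≠ y p}.Finite) :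
    ∃ N : ℕ, ∀ n ≥ N, ∀ m : ℕ, x (n, m) = y (n, m) := by
  by_contra! hne
  choose c hc r hr using hne
  refine hF ⟨r, fun f hf => ?_⟩
  obtain ⟨B, hB⟩ := ((h f hf).image Prod.fst).bddAbove
  refine ⟨B + 1, fun k hk => ?_⟩
  by_contra hlt
  have hle : f k ≤ f (c k) := hmono f hf (hc k)
  have hcB : c k ≤ B :=
    hB ⟨(c k, r k), ⟨(not_le.mp hlt).trans_le hle, hr k⟩, rfl⟩
  have := hc k
  omega

/-- Replacing the members of a `≤*`-unbounded family by their running maxima keeps it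
`≤*`-unbounded. -/
theorem unbounded_image_partialSups {G : Set (ℕ → ℕ)}
    (hG : ¬ ∃ g : ℕ → ℕ, ∀ f ∈ G, ∃ N : ℕ, ∀ n ≥ N, f n ≤ g n) :
    ¬ ∃ g : ℕ → ℕ, ∀ f ∈ (fun f : ℕ → ℕ => (partialSups f : ℕ → ℕ)) '' G,
      ∃ N : ℕ, ∀ n ≥ N, f n ≤ g n := by
  rintro ⟨g, hg⟩
  refine hG ⟨g, fun f hf => ?_⟩
  obtain ⟨N, hN⟩ := hg _ ⟨f, hf, rfl⟩
  exact ⟨N, fun n hn => (le_partialSups f n).trans (hN n hn)⟩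

/-- The family of all functions is `≤*`-unbounded. -/
theorem unbounded_univ :
    ¬ ∃ g : ℕ → ℕ, ∀ f ∈ (Set.univ : Set (ℕ → ℕ)), ∃ N : ℕ, ∀ n ≥ N, f n ≤ g n := by
  rintro ⟨g, hg⟩
  obtain ⟨N, hN⟩ := hg (fun n => g n + 1) trivial
  exact absurd (hN N le_rfl) (Nat.not_succ_le_self _)


/-- There is a family `F` of monotone functions, with cardinality the
bounding number `𝔟` (the least cardinality of a `≤*`-unbounded subset of `ℕ^ℕ`), such
that `x ↦ ([x↾f])_{f ∈ F}` is a complete classification of `E₁`: for all `x, y`,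
`x E₁ y` iff for every `f ∈ F` the set of points below the graph of `f` at which
`x` and `y` differ is finite. -/
theorem stmt_10 :
    ∃ F : Set (ℕ → ℕ),
      (∀ f ∈ F, Monotone f) ∧
      Cardinal.mk F =
        sInf { c : Cardinal |
          ∃ G : Set (ℕ → ℕ),
            (¬ ∃ g : ℕ → ℕ, ∀ f ∈ G, ∃ N : ℕ, ∀ n ≥ N, f n ≤ g n) ∧
            Cardinal.mk G = c } ∧
      ∀ x y : ℕ × ℕ → Bool,
        (∃ N : ℕ, ∀ n ≥ N, ∀ m : ℕ, x (n, m) = y (n, m)) ↔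
          ∀ f ∈ F, {p : ℕ × ℕ | p.2 < f p.1 ∧ x p ≠ y p}.Finite := by
  obtain ⟨G, hG, hGc⟩ := csInf_mem (s := { c : Cardinal |
    ∃ G : Set (ℕ → ℕ),
      (¬ ∃ g : ℕ → ℕ, ∀ f ∈ G, ∃ N : ℕ, ∀ n ≥ N, f n ≤ g n) ∧
      Cardinal.mk G = c }) ⟨_, Set.univ, unbounded_univ, rfl⟩
  have hF := unbounded_image_partialSups hG
  have hmono : ∀ f ∈ (fun f : ℕ → ℕ => (partialSups f : ℕ → ℕ)) '' G, Monotone f := by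
    rintro _ ⟨f, -, rfl⟩
    exact (partialSups f).monotone
  refine ⟨_, hmono, le_antisymm ?_ ?_, fun x y =>
    ⟨fun h f _ => finite_diff_below_of_eventually_eq h f,
      eventually_eq_of_finite_diff_below hmono hF⟩⟩
  · rw [← hGc]
    exact Cardinal.mk_image_le
  · exact csInf_le' ⟨_, hF, rfl⟩
end
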